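/- arXiv:1505.06019 — 4 statements merged into one kernel-verified Lean document; each statement's English description precedes it below -/
import Mathlib

section
/- For every d ∈ ℝ, the matrix A_d is positive definite and A_d · A_d = X_d · X_d. (Thus A_d is the positive square root |X_d| of X_d², and 2Δ·|X_d| + X_d = (2Δ² − 1/2)·I₂.) -/
open Matrix

/-- `Δ = √(4d² + 1)`. -/
noncomputable def Δ (d : ℝ) : ℝ := Real.sqrt (4 * d ^ 2 + 1)

/-- The symmetric matrix `X_d = !![2d − 1/2, 1; 1, −2d − 1/2]`. -/
noncomputable def Xmat (d : ℝ) : Matrix (Fin 2) (Fin 2) ℝ := !![2 * d - 1/2, 1; 1, -2 * d - 1/2]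

/-- The Pauli matrix `σ₁ = !![0, 1; 1, 0]`. -/
noncomputable def sigma1 : Matrix (Fin 2) (Fin 2) ℝ := !![0, 1; 1, 0]

/-- `A_d = (2Δ)⁻¹ • ((2Δ² − 1/2) • I₂ − X_d)`, the candidate for `|X_d|`. -/
noncomputable def Amat (d : ℝ) : Matrix (Fin 2) (Fin 2) ℝ :=
  (2 * Δ d)⁻¹ • ((2 * (Δ d) ^ 2 - 1/2) • (1 : Matrix (Fin 2) (Fin 2) ℝ) - Xmat d)

theorem Δ_sq (d : ℝ) : Δ d ^ 2 = 4 * d ^ 2 + 1 :=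
  Real.sq_sqrt (by positivity)

theorem Δ_pos (d : ℝ) : 0 < Δ d :=
  Real.sqrt_pos.2 (by positivity)

theorem two_Δ_smul_Amat (d : ℝ) :
    (2 * Δ d) • Amat d = (2 * (Δ d) ^ 2 - 1/2) • (1 : Matrix (Fin 2) (Fin 2) ℝ) - Xmat d :=
  smul_inv_smul₀ (mul_pos two_pos (Δ_pos d)).ne' _

theorem posDef_smul_one_sub_Xmat (d : ℝ) :
    ((2 * (Δ d) ^ 2 - 1/2) • (1 : Matrix (Fin 2) (Fin 2) ℝ) - Xmat d).PosDef := by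
  refine PosDef.of_dotProduct_mulVec_pos ?_ fun x hx => ?_
  · ext i j
    fin_cases i <;> fin_cases j <;> simp [Xmat]
  · have hpos : 0 < x 0 ^ 2 + x 1 ^ 2 := by
      by_contra! h
      have h0 : x 0 = 0 := by nlinarith [sq_nonneg (x 1)]
      have h1 : x 1 = 0 := by nlinarith [sq_nonneg (x 0)]
      exact hx (funext (Fin.forall_fin_two.2 ⟨h0, h1⟩))
    simp [Xmat, Δ_sq, dotProduct, mulVec, Fin.sum_univ_two]
    nlinarith [sq_nonneg (x 0 - x 1), mul_nonneg (sq_nonneg (4 * d - 1/2)) (sq_nonneg (x 0)),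
      mul_nonneg (sq_nonneg (4 * d + 1/2)) (sq_nonneg (x 1)),
      mul_nonneg (sq_nonneg d) (sq_nonneg (x 0)), mul_nonneg (sq_nonneg d) (sq_nonneg (x 1))]

theorem smul_one_sub_Xmat_mul_self (d : ℝ) :
    ((2 * (Δ d) ^ 2 - 1/2) • (1 : Matrix (Fin 2) (Fin 2) ℝ) - Xmat d) *
        ((2 * (Δ d) ^ 2 - 1/2) • (1 : Matrix (Fin 2) (Fin 2) ℝ) - Xmat d) =
      (2 * Δ d) ^ 2 • (Xmat d * Xmat d) := by
  rw [mul_pow, Δ_sq]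
  ext i j
  fin_cases i <;> fin_cases j <;> simp [Xmat, mul_apply, Fin.sum_univ_two] <;> ring

/-- `A_d` is positive definite with `A_d² = X_d²` (so `A_d = |X_d|`), and
`2Δ·|X_d| + X_d = (2Δ² − 1/2)·I₂`. -/
theorem Amat_posDef_and_sq_eq (d : ℝ) :
    (Amat d).PosDef ∧ Amat d * Amat d = Xmat d * Xmat d ∧
      (2 * Δ d) • Amat d + Xmat d
        = (2 * (Δ d) ^ 2 - 1/2) • (1 : Matrix (Fin 2) (Fin 2) ℝ) := by
  have hΔ : 0 < 2 * Δ d := mul_pos two_pos (Δ_pos d)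
  refine ⟨(posDef_smul_one_sub_Xmat d).smul (inv_pos.2 hΔ), ?_, ?_⟩
  · rw [Amat, smul_mul_smul_comm, smul_one_sub_Xmat_mul_self, smul_smul, ← sq, ← mul_pow,
      inv_mul_cancel₀ hΔ.ne', one_pow, one_smul]
  · rw [two_Δ_smul_Amat, sub_add_cancel]
end

section
/- For every d ∈ ℝ, the quadratic p_d has exactly one positive real root χ⁺ and exactly one negative real root χ⁻ (i.e. there is a unique χ⁺ > 0 with p_d(χ⁺) = 0 and a unique χ⁻ < 0 with p_d(χ⁻) = 0). Moreover these roots satisfy 1/2 ≤ χ⁺ ≤ Δ² − 1/2, χ⁺ + χ⁻ = −Δ⁻¹, 0 ≤ χ⁺ − 1/2 ≤ 4d², and |χ⁻ + 3/2| ≤ 4d². -/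
/-- The quadratic `p_d(λ) = λ² + Δ⁻¹λ + 1/4 − Δ²`. -/
noncomputable def pquad (d lam : ℝ) : ℝ := lam ^ 2 + (Δ d)⁻¹ * lam + 1/4 - (Δ d) ^ 2

/-- `p_d` has a unique positive root `χ⁺` and a unique negative root `χ⁻`, and these satisfy
`1/2 ≤ χ⁺ ≤ Δ² − 1/2`, `χ⁺ + χ⁻ = −Δ⁻¹`, `0 ≤ χ⁺ − 1/2 ≤ 4d²` and `|χ⁻ + 3/2| ≤ 4d²`. -/
theorem pquad_roots (d : ℝ) :
    ∃ χp χm : ℝ,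
      (0 < χp ∧ pquad d χp = 0 ∧ ∀ x : ℝ, 0 < x → pquad d x = 0 → x = χp) ∧
      (χm < 0 ∧ pquad d χm = 0 ∧ ∀ x : ℝ, x < 0 → pquad d x = 0 → x = χm) ∧
      1/2 ≤ χp ∧ χp ≤ (Δ d) ^ 2 - 1/2 ∧
      χp + χm = -(Δ d)⁻¹ ∧
      0 ≤ χp - 1/2 ∧ χp - 1/2 ≤ 4 * d ^ 2 ∧
      |χm + 3/2| ≤ 4 * d ^ 2 := by
  have hsq : (Δ d) ^ 2 = 4 * d ^ 2 + 1 := Real.sq_sqrt (by positivity)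
  have hD : 1 ≤ Δ d := Real.one_le_sqrt.mpr (by nlinarith [sq_nonneg d])
  simp only [pquad]
  rw [show 4 * d ^ 2 = (Δ d) ^ 2 - 1 by linarith]
  clear hsq
  generalize Δ d = D at hD ⊢
  have ht : D * D⁻¹ = 1 := mul_inv_cancel₀ (by positivity)
  have ht0 : 0 < D⁻¹ := by positivity
  have ht1 : D⁻¹ ≤ 1 := inv_le_one_of_one_le₀ hD
  generalize D⁻¹ = t at ht ht0 ht1 ⊢
  have hs2 : √(t ^ 2 + 4 * D ^ 2 - 1) ^ 2 = t ^ 2 + 4 * D ^ 2 - 1 :=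
    Real.sq_sqrt (by nlinarith)
  have hs0 : 0 ≤ √(t ^ 2 + 4 * D ^ 2 - 1) := Real.sqrt_nonneg _
  generalize √(t ^ 2 + 4 * D ^ 2 - 1) = s at hs2 hs0
  obtain ⟨u, rfl⟩ : ∃ u, s = 2 * u + t := ⟨(s - t) / 2, by ring⟩
  have hu : u ^ 2 + t * u + 1 / 4 - D ^ 2 = 0 := by linarith
  have hlow : 1 / 2 ≤ u := by
    by_contra! h
    nlinarith [mul_nonneg hs0 (sub_nonneg.mpr h.le)]
  have hupp : u ≤ D ^ 2 - 1 / 2 := by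
    by_contra! h
    have hD2 : 1 ≤ D ^ 2 := by nlinarith
    have hval : (D ^ 2 - 1 / 2) ^ 2 + t * (D ^ 2 - 1 / 2) + 1 / 4 - D ^ 2
        = (D ^ 2 - 1) ^ 2 + (D - 1 / 2 - t / 2) := by
      linear_combination D * ht
    have hneg : 0 < (u - (D ^ 2 - 1 / 2)) * (u + (D ^ 2 - 1 / 2) + t) :=
      mul_pos (by linarith) (by linarith)
    nlinarith [sq_nonneg (D ^ 2 - 1)]
  have hfactor (x : ℝ) (hx : x ^ 2 + t * x + 1 / 4 - D ^ 2 = 0) : x = u ∨ x = -t - u := by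
    have : (x - u) * (x - (-t - u)) = 0 := by linear_combination hx - hu
    rcases mul_eq_zero.mp this with h | h
    · exact Or.inl (by linarith)
    · exact Or.inr (by linarith)
  have hgap : 1 - t ≤ D ^ 2 - 1 := by
    nlinarith [mul_nonneg (sub_nonneg.mpr hD) (sub_nonneg.mpr ht1)]
  refine ⟨u, -t - u, ⟨by linarith, hu, fun x hx h => ?_⟩,
    ⟨by linarith, by linear_combination hu, fun x hx h => ?_⟩,
    hlow, hupp, by ring, by linarith, by linarith, abs_le.mpr ⟨by linarith, by linarith⟩⟩
  · exact (hfactor x h).resolve_right (by intro h'; linarith)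
  · exact (hfactor x h).resolve_left (by intro h'; linarith)
end

section
/- Let d ∈ ℝ and suppose χ⁺, χ⁻ ∈ ℝ satisfy p_d(χ⁺) = 0 with χ⁺ > 0 and p_d(χ⁻) = 0 with χ⁻ < 0. Set κ⁺ = 1/χ⁺ and κ⁻ = 1/χ⁻. Then 0 < κ⁺ ≤ 2, |d|·κ⁺ ≤ 1, |κ⁺ − 2| ≤ 16d², and −2 ≤ κ⁻ < 0, |d|·|κ⁻| ≤ 1, |κ⁻ + 2/3| ≤ 16d². -/
/-- The inverse of `Δ` lies in `(0, 1]`, and it differs from `1` by at most `2d²`. -/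
theorem Δ_inv_bounds (d : ℝ) : 0 < (Δ d)⁻¹ ∧ (Δ d)⁻¹ ≤ 1 ∧ 1 - (Δ d)⁻¹ ≤ 2 * d ^ 2 := by
  have hsq : Δ d ^ 2 = 4 * d ^ 2 + 1 := Real.sq_sqrt (by positivity)
  have h0 : 0 ≤ Δ d := Real.sqrt_nonneg _
  have h1 : 1 ≤ Δ d := by nlinarith [sq_nonneg d]
  have hinv : (Δ d)⁻¹ * Δ d = 1 := inv_mul_cancel₀ (by linarith)
  have hpos : 0 < (Δ d)⁻¹ := inv_pos.2 (by linarith)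
  have hle : (Δ d)⁻¹ ≤ 1 := inv_le_one_of_one_le₀ h1
  refine ⟨hpos, hle, ?_⟩
  have h2 : 1 - (Δ d)⁻¹ = (Δ d)⁻¹ * (Δ d - 1) := by rw [mul_sub, hinv, mul_one]
  nlinarith [mul_le_mul_of_nonneg_right hle (sub_nonneg.2 h1)]

theorem pquad_eq_zero_iff (d x : ℝ) :
    pquad d x = 0 ↔ x ^ 2 + (Δ d)⁻¹ * x = 4 * d ^ 2 + 3 / 4 := by
  have hsq : Δ d ^ 2 = 4 * d ^ 2 + 1 := Real.sq_sqrt (by positivity)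
  rw [pquad, hsq]
  constructor <;> intro h <;> linarith

/-- A positive solution of `x² + ex = 4d² + 3/4` with `|e| ≤ 1` is at least `1/2` and at least
`|d|`. -/
theorem half_le_and_abs_le_of_sq_add_mul_eq {d e x : ℝ} (he : |e| ≤ 1) (hx : 0 < x)
    (h : x ^ 2 + e * x = 4 * d ^ 2 + 3 / 4) : 1 / 2 ≤ x ∧ |d| ≤ x := by
  have hle : e * x ≤ x := by nlinarith [(abs_le.1 he).2]
  have hd : |d| ^ 2 = d ^ 2 := sq_abs d
  have hd0 := abs_nonneg d
  constructor
  · by_contra! hlt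
    nlinarith [sq_nonneg d]
  · by_contra! hlt
    nlinarith [sq_nonneg (|d| - 1 / 2)]

/-- If `χ⁺ > 0` and `χ⁻ < 0` are roots of `p_d`, then their reciprocals `κ± = 1/χ±` satisfy
`0 < κ⁺ ≤ 2`, `|d|·κ⁺ ≤ 1`, `|κ⁺ − 2| ≤ 16d²`, and `−2 ≤ κ⁻ < 0`, `|d|·|κ⁻| ≤ 1`,
`|κ⁻ + 2/3| ≤ 16d²`. -/
theorem kappa_bounds (d : ℝ) (χp χm : ℝ) (hp : pquad d χp = 0) (hp' : 0 < χp)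
    (hm : pquad d χm = 0) (hm' : χm < 0) :
    (0 < 1/χp ∧ 1/χp ≤ 2 ∧ |d| * (1/χp) ≤ 1 ∧ |1/χp - 2| ≤ 16 * d ^ 2) ∧
    (-2 ≤ 1/χm ∧ 1/χm < 0 ∧ |d| * |1/χm| ≤ 1 ∧ |1/χm + 2/3| ≤ 16 * d ^ 2) := by
  obtain ⟨he0, he1, he2⟩ := Δ_inv_bounds d
  rw [pquad_eq_zero_iff] at hp hm
  generalize (Δ d)⁻¹ = e at *
  obtain ⟨y, rfl⟩ : ∃ y, χm = -y := ⟨-χm, (neg_neg _).symm⟩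
  have hy : 0 < y := by linarith
  have hm₁ : y ^ 2 + -e * y = 4 * d ^ 2 + 3 / 4 := by linarith
  obtain ⟨hp_half, hp_abs⟩ :=
    half_le_and_abs_le_of_sq_add_mul_eq (abs_le.2 ⟨by linarith, he1⟩) hp' hp
  obtain ⟨hm_half, hm_abs⟩ :=
    half_le_and_abs_le_of_sq_add_mul_eq (abs_le.2 ⟨by linarith, by linarith⟩) hy hm₁
  have hy_inv : 1 / y ≤ 2 := by rw [div_le_iff₀ hy]; linarith
  have hx_inv : 1 / χp ≤ 2 := by rw [div_le_iff₀ hp']; linarith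
  have hneg : 1 / -y = -(1 / y) := by rw [div_neg]
  have hd := sq_nonneg d
  refine ⟨⟨by positivity, hx_inv, ?_, ?_⟩, ?_, ?_, ?_, ?_⟩
  · rw [mul_one_div, div_le_one hp']; exact hp_abs
  · rw [abs_of_nonpos (by linarith)]
    have hfac : (χp - 1 / 2) * (χp + 1 / 2 + e) ≤ 5 * d ^ 2 := by nlinarith
    have hmul : 1 ≤ χp * (χp + 1 / 2 + e) := by nlinarith
    have hmain : 2 * χp - 1 ≤ 16 * d ^ 2 * χp := by
      refine le_of_mul_le_mul_right ?_ (show 0 < χp + 1 / 2 + e by linarith)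
      nlinarith [mul_le_mul_of_nonneg_left hmul hd]
    have heq : -(1 / χp - 2) = (2 * χp - 1) / χp := by field_simp; ring
    rw [heq, div_le_iff₀ hp']
    exact hmain
  · rw [hneg]; linarith
  · rw [hneg]; exact neg_neg_of_pos (by positivity)
  · rw [hneg, abs_neg, abs_of_pos (one_div_pos.2 hy), mul_one_div, div_le_one hy]; exact hm_abs
  · have hc : 0 < y + 3 / 2 - e := by linarith
    have hfac : (y - 3 / 2) * (y + 3 / 2 - e) = 4 * d ^ 2 - 3 / 2 * (1 - e) := by linarith
    have hy_ge : 0 ≤ y - 3 / 2 := nonneg_of_mul_nonneg_left (by rw [hfac]; linarith) hc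
    have hmul : 1 ≤ y * (y + 3 / 2 - e) := by nlinarith
    have hmain : 2 * y - 3 ≤ 16 * d ^ 2 * (3 * y) := by
      refine le_of_mul_le_mul_right ?_ hc
      nlinarith [mul_le_mul_of_nonneg_left hmul hd]
    have heq : 1 / -y + 2 / 3 = (2 * y - 3) / (3 * y) := by rw [hneg]; field_simp; ring
    rw [heq, abs_of_nonneg (div_nonneg (by linarith) (by linarith)), div_le_iff₀ (by linarith)]
    exact hmain
end

section
/- Let a ≥ 0 and set C₁ = 4·exp(a/2). Let μ : ℝ → ℝ be differentiable with |μ′(t)| ≤ a·|μ(t)| for all t ∈ ℝ, let k ∈ ℝ, and let 0 < ε ≤ 1/C₁ with |μ(k)| ≤ ε. Then there exist s₊ ∈ [k + (1 − C₁·ε)/2, k + 1/2] and s₋ ∈ [k − 1/2, k − (1 − C₁·ε)/2] such that 4·μ(s₊)² + (s₊ − k)² = 1/4 and 4·μ(s₋)² + (s₋ − k)² = 1/4. -/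
/-- Grönwall's inequality for a real function with `|f′| ≤ a·|f|`, to the right of `k`. -/
theorem abs_le_mul_exp_of_abs_deriv_le {a : ℝ} {f : ℝ → ℝ} (hf : Differentiable ℝ f)
    (hd : ∀ t, |deriv f t| ≤ a * |f t|) {k ε : ℝ} (hk : |f k| ≤ ε) {t : ℝ} (ht : k ≤ t) :
    |f t| ≤ ε * Real.exp (a * (t - k)) := by
  have h := norm_le_gronwallBound_of_norm_deriv_right_le (f := f) (f' := deriv f) (δ := ε)
    (K := a) (ε := 0) (a := k) (b := t) hf.continuous.continuousOn
    (fun x _ => (hf x).hasDerivAt.hasDerivWithinAt) hk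
    (fun x _ => by simpa using hd x) t ⟨ht, le_rfl⟩
  rwa [gronwallBound_ε0] at h

theorem exists_right_crossing {a : ℝ} (ha : 0 ≤ a) {f : ℝ → ℝ} (hf : Differentiable ℝ f)
    (hd : ∀ t, |deriv f t| ≤ a * |f t|) {k ε : ℝ} (hε0 : 0 < ε)
    (hε : ε ≤ 1 / (4 * Real.exp (a / 2))) (hk : |f k| ≤ ε) :
    ∃ s ∈ Set.Icc (k + (1 - 4 * Real.exp (a / 2) * ε) / 2) (k + 1 / 2),
      4 * f s ^ 2 + (s - k) ^ 2 = 1 / 4 := by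
  have hE : 0 < Real.exp (a / 2) := Real.exp_pos _
  rw [le_div_iff₀ (by positivity)] at hε
  set δ := Real.exp (a / 2) * ε with hδ
  have hδ0 : 0 < δ := by positivity
  have hδ4 : 4 * δ ≤ 1 := by linarith
  rw [mul_assoc, ← hδ]
  set x := k + (1 - 4 * δ) / 2 with hx
  have hkx : k ≤ x := by linarith
  have hx2 : x ≤ k + 1 / 2 := by linarith
  have hfx : |f x| ≤ δ := by
    refine (abs_le_mul_exp_of_abs_deriv_le hf hd hk hkx).trans ?_
    rw [hδ, mul_comm (Real.exp _)]
    gcongr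
    nlinarith
  have hcont : Continuous fun s => 4 * f s ^ 2 + (s - k) ^ 2 := by
    have := hf.continuous
    fun_prop
  refine intermediate_value_Icc hx2 hcont.continuousOn ⟨?_, ?_⟩
  · have hsq : f x ^ 2 ≤ δ ^ 2 := sq_le_sq' (abs_le.1 hfx).1 (abs_le.1 hfx).2
    have hxk : x - k = (1 - 4 * δ) / 2 := by rw [hx]; ring
    simp only [hxk]
    nlinarith
  · nlinarith [sq_nonneg (f (k + 1 / 2))]

/-- Let `C₁ = 4·exp(a/2)` and let `μ` be differentiable with `|μ′| ≤ a·|μ|`.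
If `0 < ε ≤ 1/C₁` and `|μ(k)| ≤ ε`, then the equation `4μ(s)² + (s − k)² = 1/4`
has a solution `s₊ ∈ [k + (1 − C₁ε)/2, k + 1/2]` and a solution
`s₋ ∈ [k − 1/2, k − (1 − C₁ε)/2]`. -/
theorem crossings_located (a : ℝ) (ha : 0 ≤ a) (μ : ℝ → ℝ)
    (hμ : Differentiable ℝ μ) (hd : ∀ t : ℝ, |deriv μ t| ≤ a * |μ t|)
    (k ε : ℝ) (hε0 : 0 < ε) (hε : ε ≤ 1 / (4 * Real.exp (a / 2)))
    (hk : |μ k| ≤ ε) :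
    (∃ sp ∈ Set.Icc (k + (1 - 4 * Real.exp (a / 2) * ε) / 2) (k + 1/2),
        4 * μ sp ^ 2 + (sp - k) ^ 2 = 1/4) ∧
    (∃ sm ∈ Set.Icc (k - 1/2) (k - (1 - 4 * Real.exp (a / 2) * ε) / 2),
        4 * μ sm ^ 2 + (sm - k) ^ 2 = 1/4) := by
  refine ⟨exists_right_crossing ha hμ hd hε0 hε hk, ?_⟩
  obtain ⟨s, ⟨hs₁, hs₂⟩, hs⟩ := exists_right_crossing (f := fun t => μ (2 * k - t)) (k := k) ha
    (by fun_prop) (fun t => by simpa [deriv_comp_const_sub] using hd (2 * k - t)) hε0 hε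
    (by simpa [two_mul] using hk)
  exact ⟨2 * k - s, ⟨by linarith, by linarith⟩, by linear_combination hs⟩
end
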